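/- Let R be a commutative ring, g a natural number, Q the 2g×2g block-diagonal matrix over R with g diagonal blocks [[0,1],[−1,0]], and let V be a 2g×2g matrix over R satisfying V − Vᵀ = Q (where Vᵀ is the transpose of V). Then for every t ∈ R, det(1 − (t−1)·(V·Q)) = det(Vᵀ − t·V). -/

import Mathlib

open Matrix

/-- Determinant identity underlying `Z_𝔻(K) = 1/Δ_K(T) (mod ε)`: if `Q` is the standard
symplectic `2g × 2g` matrix and `V` satisfies `V - Vᵀ = Q`, then for every `t`,
`det (1 - (t-1) • (V * Q)) = det (Vᵀ - t • V)`. -/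
theorem seifert_det_identity (R : Type*) [CommRing R] (g : ℕ)
    (Q V : Matrix (Fin 2 × Fin g) (Fin 2 × Fin g) R)
    (hQ : Q = Matrix.blockDiagonal (fun _ : Fin g => !![0, 1; -1, 0]))
    (hV : V - Vᵀ = Q) (t : R) :
    (1 - (t - 1) • (V * Q)).det = (Vᵀ - t • V).det := by
  have hQQ : Q * Q = -1 := by
    rw [hQ, ← blockDiagonal_mul, ← blockDiagonal_one, ← blockDiagonal_neg]
    congr 1
    ext k i j
    fin_cases i <;> fin_cases j <;> simp
  have hdet : (-Q).det = 1 := by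
    rw [hQ, ← blockDiagonal_neg, det_blockDiagonal]
    simp [det_fin_two]
  have hmul : (1 - (t - 1) • (V * Q)) * -Q = Vᵀ - t • V := by
    rw [mul_neg, sub_mul, one_mul, smul_mul_assoc, mul_assoc, hQQ, mul_neg, mul_one, ← hV,
      sub_smul, one_smul]
    module
  rw [← hmul, det_mul, hdet, mul_one]
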